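/- Let ℱ be a fully Δ-capturing construction scheme whose type satisfies n_{k+1} ≥ 2^{m_k} for all k, let n ≥ 1, and let 𝔼_e = {e_α : α < ω₁} be defined as in the context. Then 𝔼_e, as a subset of the lexicographically ordered integer sequences ℤ^ω, is not (2n+1)-entangled: indeed, there is an uncountable family of pairwise disjoint (2n+1)-element subsets of 𝔼_e no two distinct members of which realize the alternating type τ(i) = 0 for even i, τ(i) = 1 for odd i, nor its flip τ¹. -/

import Mathlib

noncomputable section

open scoped Classical

/-- The first uncountable ordinal. -/
def omegaOne : Ordinal := (Cardinal.aleph 1).ord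

/-- A scheme type. -/
structure SchemeType where
  m : ℕ → ℕ
  n : ℕ → ℕ
  r : ℕ → ℕ
  m_zero : m 0 = 1
  n_ge : ∀ k, 2 ≤ n (k + 1)
  r_lt : ∀ k, r (k + 1) < m k
  m_succ : ∀ k, m (k + 1) = r (k + 1) + (m k - r (k + 1)) * n (k + 1)

/-- `A` is an initial segment of `B`. -/
def InitSeg (A B : Finset Ordinal) : Prop := ∀ a ∈ A, ∀ b ∈ B, b < a → b ∈ A

/-- `D`, `R` form the canonical decomposition of `F ∈ ℱ_{k+1}`. -/
def IsDecomposition (T : SchemeType) (ℱ : Set (Finset Ordinal)) (k : ℕ)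
    (F : Finset Ordinal) (D : ℕ → Finset Ordinal) (R : Finset Ordinal) : Prop :=
  (∀ i < T.n (k + 1), D i ∈ ℱ ∧ (D i).card = T.m k) ∧
  F = (Finset.range (T.n (k + 1))).biUnion D ∧
  R.card = T.r (k + 1) ∧
  (∀ i < T.n (k + 1), ∀ j < T.n (k + 1), i ≠ j → D i ∩ D j = R) ∧
  (∀ i < T.n (k + 1), ∀ x ∈ R, ∀ y ∈ D i \ R, x < y) ∧
  (∀ i j, i < j → j < T.n (k + 1) → ∀ x ∈ D i \ R, ∀ y ∈ D j \ R, x < y)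

/-- `ℱ` is a construction scheme of type `T` on `ω₁`. -/
structure IsConstructionScheme (T : SchemeType) (ℱ : Set (Finset Ordinal)) : Prop where
  nonempty_mem : ∀ F ∈ ℱ, F.Nonempty
  mem_subset : ∀ F ∈ ℱ, ↑F ⊆ Set.Iio omegaOne
  cofinal : ∀ A : Finset Ordinal, ↑A ⊆ Set.Iio omegaOne → ∃ F ∈ ℱ, A ⊆ F
  card_eq : ∀ F ∈ ℱ, ∃ k, F.card = T.m k
  inter_initSeg : ∀ k : ℕ, ∀ E ∈ ℱ, ∀ F ∈ ℱ, E.card = T.m k → F.card = T.m k →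
    InitSeg (E ∩ F) E ∧ InitSeg (E ∩ F) F
  decomp : ∀ k : ℕ, ∀ F ∈ ℱ, F.card = T.m (k + 1) → ∃ D R, IsDecomposition T ℱ k F D R

/-- `ρ(α,β)`: least `k` such that `{α,β}` is included in a member of `ℱ_k`. -/
def rho (T : SchemeType) (ℱ : Set (Finset Ordinal)) (α β : Ordinal) : ℕ :=
  sInf {k | ∃ F ∈ ℱ, F.card = T.m k ∧ α ∈ F ∧ β ∈ F}

/-- `‖α‖_k`, the cardinality of `(α)_k \ {α}`. -/
def nrm (T : SchemeType) (ℱ : Set (Finset Ordinal)) (α : Ordinal) (k : ℕ) : ℕ :=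
  Set.ncard {ξ : Ordinal | ξ < α ∧ rho T ℱ α ξ ≤ k}

/-- `Δ(α,β)`: least `k` with `‖α‖_k ≠ ‖β‖_k`. -/
def deltaOrd (T : SchemeType) (ℱ : Set (Finset Ordinal)) (α β : Ordinal) : ℕ :=
  sInf {k | nrm T ℱ α k ≠ nrm T ℱ β k}

/-- `Ξ_α(k)`. -/
def Xi (T : SchemeType) (ℱ : Set (Finset Ordinal)) (α : Ordinal) (k : ℕ) : ℤ :=
  if k = 0 then 0
  else if h : ∃ i : ℕ, ∃ F ∈ ℱ, ∃ D R, F.card = T.m k ∧ α ∈ F ∧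
      IsDecomposition T ℱ (k - 1) F D R ∧ i < T.n k ∧ α ∈ D i ∧ α ∉ R
  then (h.choose : ℤ) else -1

/-- The `a`-th element of a finite set of ordinals, in increasing order. -/
def elt (A : Finset Ordinal) (a : ℕ) : Ordinal := (A.sort (· ≤ ·)).getD a 0

/-- The family `⟨D_0, …, D_{j-1}⟩` is Δ-captured at level `l`. -/
def DeltaCapturedFam (T : SchemeType) (ℱ : Set (Finset Ordinal)) (j : ℕ)
    (D : ℕ → Finset Ordinal) (l : ℕ) : Prop :=
  ∃ R : Finset Ordinal,
    (∀ i < j, ∀ i' < j, (D i).card = (D i').card) ∧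
    (∀ i < j, ∀ i' < j, i ≠ i' → D i ∩ D i' = R) ∧
    (∀ i < j, ∀ x ∈ R, ∀ y ∈ D i \ R, x < y) ∧
    (∀ i i', i < i' → i' < j → ∀ x ∈ D i \ R, ∀ y ∈ D i' \ R, x < y) ∧
    (∀ i < j, ∀ a < R.card, Xi T ℱ (elt (D i) a) l = -1) ∧
    (∀ i < j, ∀ a, R.card ≤ a → a < (D i).card → Xi T ℱ (elt (D i) a) l = (i : ℤ)) ∧
    (∀ i < j, ∀ i' < j, i ≠ i' → ∀ a, R.card ≤ a → a < (D i).card →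
      deltaOrd T ℱ (elt (D i) a) (elt (D i') a) = l)

/-- The family `⟨D_0, …, D_{j-1}⟩` is captured at level `l`. -/
def CapturedFam (T : SchemeType) (ℱ : Set (Finset Ordinal)) (j : ℕ)
    (D : ℕ → Finset Ordinal) (l : ℕ) : Prop :=
  DeltaCapturedFam T ℱ j D l ∧
  ∀ i < j, ∀ i' < j, i ≠ i' → ∀ a, (D i ∩ D i').card ≤ a → a < (D i).card →
    rho T ℱ (elt (D i) a) (elt (D i') a) = l

/-- The ordered pair `⟨A, B⟩`, as a family. -/
def pairFam (A B : Finset Ordinal) : ℕ → Finset Ordinal := fun i => if i = 0 then A else B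

/-- A pair of ordinals `α < β` is captured at level `l`, i.e. `⟨{α},{β}⟩` is. -/
def CapturedPair (T : SchemeType) (ℱ : Set (Finset Ordinal)) (α β : Ordinal) (l : ℕ) : Prop :=
  α < β ∧ Xi T ℱ α l = 0 ∧ Xi T ℱ β l = 1 ∧ deltaOrd T ℱ α β = l ∧ rho T ℱ α β = l

/-- `ℱ` is a 2-Δ-capturing scheme. -/
def TwoDeltaCapturing (T : SchemeType) (ℱ : Set (Finset Ordinal)) : Prop :=
  ∀ 𝒮 : Set (Finset Ordinal), (∀ A ∈ 𝒮, A.Nonempty ∧ ↑A ⊆ Set.Iio omegaOne) →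
    ¬ 𝒮.Countable →
    {l : ℕ | ∃ A ∈ 𝒮, ∃ B ∈ 𝒮, A ≠ B ∧ DeltaCapturedFam T ℱ 2 (pairFam A B) l}.Infinite

/-- `ℱ` is a 2-capturing scheme. -/
def TwoCapturing (T : SchemeType) (ℱ : Set (Finset Ordinal)) : Prop :=
  ∀ 𝒮 : Set (Finset Ordinal), (∀ A ∈ 𝒮, A.Nonempty ∧ ↑A ⊆ Set.Iio omegaOne) →
    ¬ 𝒮.Countable →
    {l : ℕ | ∃ A ∈ 𝒮, ∃ B ∈ 𝒮, A ≠ B ∧ CapturedFam T ℱ 2 (pairFam A B) l}.Infinite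

/-- `ℱ` is a fully Δ-capturing scheme. -/
def FullyDeltaCapturing (T : SchemeType) (ℱ : Set (Finset Ordinal)) : Prop :=
  ∀ 𝒮 : Set (Finset Ordinal), (∀ A ∈ 𝒮, A.Nonempty ∧ ↑A ⊆ Set.Iio omegaOne) →
    ¬ 𝒮.Countable →
    {l : ℕ | ∃ D : ℕ → Finset Ordinal, (∀ i < T.n l, D i ∈ 𝒮) ∧
      (∀ i < T.n l, ∀ i' < T.n l, i ≠ i' → D i ≠ D i') ∧
      DeltaCapturedFam T ℱ (T.n l) D l}.Infinite

/-- `E` is an `n`-entangled subset of the linear order `X`. -/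
def IsNEntangled {X : Type*} [LinearOrder X] (E : Set X) (n : ℕ) : Prop :=
  ¬ E.Countable ∧
  ∀ τ : Fin n → Fin 2, ∀ 𝒜 : Set (Fin n → X),
    (∀ a ∈ 𝒜, StrictMono a ∧ ∀ i, a i ∈ E) →
    (𝒜.Pairwise fun a b => ∀ i j, a i ≠ b j) →
    ¬ 𝒜.Countable →
    ∃ a ∈ 𝒜, ∃ b ∈ 𝒜, a ≠ b ∧ ∀ i, (a i < b i ↔ τ i = 0)


/-- The sequence `e_α` (depending on a parameter `nn` and the chosen enumerations `C`). -/
def eSeq (T : SchemeType) (ℱ : Set (Finset Ordinal)) (C : ℕ → ℕ → Finset ℕ) (nn : ℕ)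
    (α : Ordinal) : ℕ → ℤ := fun k =>
  if Xi T ℱ α k ≤ 0 then 0
  else if nrm T ℱ α (k - 1) ∈ C (k - 1) (Xi T ℱ α k).toNat ∨
      ((C (k - 1) (Xi T ℱ α k).toNat).card = nn ∧
        ∀ c ∈ C (k - 1) (Xi T ℱ α k).toNat, nrm T ℱ α (k - 1) < c)
  then Xi T ℱ α k
  else -(Xi T ℱ α k)

/-- The sequence `o_α` (depending on the chosen enumerations `C`). -/
def oSeq (T : SchemeType) (ℱ : Set (Finset Ordinal)) (C : ℕ → ℕ → Finset ℕ)
    (α : Ordinal) : ℕ → ℤ := fun k =>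
  if Xi T ℱ α k ≤ 0 then 0
  else if nrm T ℱ α (k - 1) ∈ C (k - 1) (Xi T ℱ α k).toNat
  then Xi T ℱ α k
  else -(Xi T ℱ α k)

/-- `C` is an enumeration `⟨C^k_i⟩_{0<i<n_{k+1}}` (possibly with repetitions) of all subsets of
`m_k ∖ r_{k+1}` of cardinality at most `nn`. -/
def IsGoodEnum (T : SchemeType) (nn : ℕ) (C : ℕ → ℕ → Finset ℕ) : Prop :=
  (∀ k, ∀ i, 0 < i → i < T.n (k + 1) →
    C k i ⊆ Finset.Ico (T.r (k + 1)) (T.m k) ∧ (C k i).card ≤ nn) ∧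
  (∀ k, ∀ s : Finset ℕ, s ⊆ Finset.Ico (T.r (k + 1)) (T.m k) → s.card ≤ nn →
    ∃ i, 0 < i ∧ i < T.n (k + 1) ∧ C k i = s)

namespace SchemeType

variable (T : SchemeType)

lemma m_strictMono : StrictMono T.m := by
  refine strictMono_nat_of_lt_succ fun k => ?_
  have h1 := T.r_lt k
  have h2 := T.n_ge k
  rw [T.m_succ k]
  have h3 : (T.m k - T.r (k + 1)) * 2 ≤ (T.m k - T.r (k + 1)) * T.n (k + 1) :=
    Nat.mul_le_mul_left _ h2
  omega

end SchemeType

lemma omegaOne_isPrincipal_add : Ordinal.IsPrincipal (· + ·) omegaOne :=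
  Ordinal.isPrincipal_add_ord (Cardinal.aleph0_le_aleph 1)

lemma omegaOne_isPrincipal_mul : Ordinal.IsPrincipal (· * ·) omegaOne :=
  Ordinal.isPrincipal_mul_ord (Cardinal.aleph0_le_aleph 1)

lemma omega0_lt_omegaOne : Ordinal.omega0 < omegaOne := by
  rw [omegaOne, ← Cardinal.ord_aleph0]
  exact Cardinal.ord_lt_ord.2 Cardinal.aleph0_lt_aleph_one

lemma natCast_lt_omegaOne (t : ℕ) : (t : Ordinal) < omegaOne :=
  (Ordinal.natCast_lt_omega0 t).trans omega0_lt_omegaOne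

lemma not_countable_Iio_omegaOne : ¬ (Set.Iio omegaOne).Countable := by
  rw [← Cardinal.le_aleph0_iff_set_countable, Cardinal.mk_Iio_ordinal, omegaOne, Cardinal.card_ord]
  simp

/-- The block of ordinals `ω * γ, ω * γ + 1, …`. -/
def block (γ : Ordinal) (t : ℕ) : Ordinal := Ordinal.omega0 * γ + t

lemma block_lt_omegaOne {γ : Ordinal} (h : γ < omegaOne) (t : ℕ) : block γ t < omegaOne :=
  omegaOne_isPrincipal_add (omegaOne_isPrincipal_mul omega0_lt_omegaOne h) (natCast_lt_omegaOne t)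

lemma block_inj {γ γ' : Ordinal} {t t' : ℕ} (h : block γ t = block γ' t') : γ = γ' ∧ t = t' := by
  have h0 : γ = γ' := by
    have := congrArg (· / Ordinal.omega0) h
    simpa [block, Ordinal.mul_add_div _ Ordinal.omega0_ne_zero,
      Ordinal.div_eq_zero_of_lt (Ordinal.natCast_lt_omega0 _)] using this
  subst h0
  exact ⟨rfl, by simpa [block] using h⟩

namespace IsDecomposition

variable {T : SchemeType} {ℱ : Set (Finset Ordinal)} {k : ℕ} {F R : Finset Ordinal}
  {D : ℕ → Finset Ordinal}

lemma root_subset (h : IsDecomposition T ℱ k F D R) {i : ℕ} (hi : i < T.n (k + 1)) :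
    R ⊆ D i := by
  obtain ⟨-, -, -, hR, -, -⟩ := h
  have h2 := T.n_ge k
  obtain ⟨j, hj, hij⟩ : ∃ j < T.n (k + 1), i ≠ j := by
    rcases Nat.eq_zero_or_pos i with rfl | h0
    · exact ⟨1, by omega, by omega⟩
    · exact ⟨0, by omega, by omega⟩
  rw [← hR i hi j hj hij]
  exact Finset.inter_subset_left

lemma piece_subset (h : IsDecomposition T ℱ k F D R) {i : ℕ} (hi : i < T.n (k + 1)) :
    D i ⊆ F := by
  rw [h.2.1]
  exact Finset.subset_biUnion_of_mem D (Finset.mem_range.2 hi)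

lemma exists_mem_piece (h : IsDecomposition T ℱ k F D R) {α : Ordinal} (hα : α ∈ F) :
    ∃ i < T.n (k + 1), α ∈ D i := by
  rw [h.2.1] at hα
  simpa using hα

lemma card_sdiff_root (h : IsDecomposition T ℱ k F D R) {i : ℕ} (hi : i < T.n (k + 1)) :
    (D i \ R).card = T.m k - T.r (k + 1) := by
  rw [Finset.card_sdiff_of_subset (h.root_subset hi), (h.1 i hi).2, h.2.2.1]

lemma filter_lt_of_mem_root (h : IsDecomposition T ℱ k F D R) {i : ℕ} (hi : i < T.n (k + 1))
    {α : Ordinal} (hα : α ∈ R) : F.filter (· < α) = (D i).filter (· < α) := by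
  ext x
  simp only [Finset.mem_filter, and_congr_left_iff]
  refine fun hx => ⟨fun hxF => ?_, fun hxD => h.piece_subset hi hxD⟩
  obtain ⟨j, hj, hxj⟩ := h.exists_mem_piece hxF
  by_cases hxR : x ∈ R
  · exact h.root_subset hi hxR
  · exact absurd hx (h.2.2.2.2.1 j hj α hα x (Finset.mem_sdiff.2 ⟨hxj, hxR⟩)).not_gt

lemma filter_lt_of_notMem_root (h : IsDecomposition T ℱ k F D R) {i : ℕ} (hi : i < T.n (k + 1))
    {α : Ordinal} (hα : α ∈ D i) (hαR : α ∉ R) :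
    F.filter (· < α) = (D i).filter (· < α) ∪ (Finset.range i).biUnion fun j => D j \ R := by
  have hαi : α ∈ D i \ R := Finset.mem_sdiff.2 ⟨hα, hαR⟩
  ext x
  simp only [Finset.mem_filter, Finset.mem_union, Finset.mem_biUnion, Finset.mem_range]
  constructor
  · rintro ⟨hxF, hx⟩
    by_cases hxR : x ∈ R
    · exact Or.inl ⟨h.root_subset hi hxR, hx⟩
    obtain ⟨j, hj, hxj⟩ := h.exists_mem_piece hxF
    have hxj' : x ∈ D j \ R := Finset.mem_sdiff.2 ⟨hxj, hxR⟩
    rcases lt_trichotomy j i with hji | rfl | hij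
    · exact Or.inr ⟨j, hji, hxj'⟩
    · exact Or.inl ⟨hxj, hx⟩
    · exact absurd hx (h.2.2.2.2.2 i j hij hj α hαi x hxj').not_gt
  · rintro (⟨hxD, hx⟩ | ⟨j, hj, hx⟩)
    · exact ⟨h.piece_subset hi hxD, hx⟩
    · exact ⟨h.piece_subset (hj.trans hi) (Finset.mem_sdiff.1 hx).1,
        h.2.2.2.2.2 j i hj hi x hx α hαi⟩

lemma card_filter_lt_of_notMem_root (h : IsDecomposition T ℱ k F D R) {i : ℕ}
    (hi : i < T.n (k + 1)) {α : Ordinal} (hα : α ∈ D i) (hαR : α ∉ R) :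
    (F.filter (· < α)).card =
      ((D i).filter (· < α)).card + i * (T.m k - T.r (k + 1)) := by
  have hlt : ∀ j ∈ Finset.range i, j < T.n (k + 1) :=
    fun j hj => (Finset.mem_range.1 hj).trans hi
  have hdisj : ∀ j < T.n (k + 1), ∀ j' < T.n (k + 1), j ≠ j' → ∀ x ∈ D j \ R, x ∉ D j' := by
    intro j hj j' hj' hne x hx hx'
    have hxx := Finset.mem_sdiff.1 hx
    exact hxx.2 (h.2.2.2.1 j hj j' hj' hne ▸ Finset.mem_inter.2 ⟨hxx.1, hx'⟩)
  rw [h.filter_lt_of_notMem_root hi hα hαR, Finset.card_union_of_disjoint, Finset.card_biUnion,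
    Finset.sum_congr rfl fun j hj => h.card_sdiff_root (hlt j hj)]
  · simp
  · intro j hj j' hj' hne
    exact Finset.disjoint_left.2 fun x hx hx' =>
      hdisj j (hlt j hj) j' (hlt j' hj') hne x hx (Finset.mem_sdiff.1 hx').1
  · refine Finset.disjoint_left.2 fun x hx hx' => ?_
    obtain ⟨j, hj, hxj⟩ := Finset.mem_biUnion.1 hx'
    exact hdisj j (hlt j hj) i hi (Finset.mem_range.1 hj).ne x hxj (Finset.mem_filter.1 hx).1

lemma root_card_le (h : IsDecomposition T ℱ k F D R) {i : ℕ} (hi : i < T.n (k + 1))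
    {α : Ordinal} (hα : α ∈ D i) (hαR : α ∉ R) :
    T.r (k + 1) ≤ ((D i).filter (· < α)).card := by
  rw [← h.2.2.1]
  exact Finset.card_le_card fun x hx => Finset.mem_filter.2
    ⟨h.root_subset hi hx, h.2.2.2.2.1 i hi x hx α (Finset.mem_sdiff.2 ⟨hα, hαR⟩)⟩

lemma card_filter_lt_root (h : IsDecomposition T ℱ k F D R) {α : Ordinal} (hα : α ∈ R) :
    (F.filter (· < α)).card < T.r (k + 1) := by
  have h0 : 0 < T.n (k + 1) := by have := T.n_ge k; omega
  rw [← h.2.2.1]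
  refine Finset.card_lt_card ((Finset.ssubset_iff_of_subset fun x hx => ?_).2
    ⟨α, hα, by simp⟩)
  obtain ⟨hxF, hx⟩ := Finset.mem_filter.1 hx
  obtain ⟨j, hj, hxj⟩ := h.exists_mem_piece hxF
  by_contra hxR
  exact absurd hx (h.2.2.2.2.1 j hj α hα x (Finset.mem_sdiff.2 ⟨hxj, hxR⟩)).not_gt

end IsDecomposition

namespace IsConstructionScheme

variable {T : SchemeType} {ℱ : Set (Finset Ordinal)}

lemma exists_superset_of_le (hS : IsConstructionScheme T ℱ) (A : Finset Ordinal)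
    (hA : ↑A ⊆ Set.Iio omegaOne) (k : ℕ) :
    ∃ p, k ≤ p ∧ ∃ F ∈ ℱ, F.card = T.m p ∧ A ⊆ F := by
  let B : Finset Ordinal := (Finset.range (T.m k)).image fun t : ℕ => (t : Ordinal)
  have hB : B.card = T.m k := by
    rw [Finset.card_image_of_injective _ Nat.cast_injective, Finset.card_range]
  obtain ⟨F, hF, hAF⟩ := hS.cofinal (A ∪ B) <| by
    intro x hx
    rcases Finset.mem_union.1 (Finset.mem_coe.1 hx) with h | h
    · exact hA h
    · obtain ⟨t, -, rfl⟩ := Finset.mem_image.1 h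
      exact natCast_lt_omegaOne t
  obtain ⟨p, hp⟩ := hS.card_eq F hF
  refine ⟨p, T.m_strictMono.le_iff_le.1 ?_, F, hF, hp, Finset.union_subset_left hAF⟩
  rw [← hp, ← hB]
  exact Finset.card_le_card (Finset.union_subset_right hAF)

lemma exists_mem_level (hS : IsConstructionScheme T ℱ) {α : Ordinal} (hα : α < omegaOne)
    (k : ℕ) : ∃ F ∈ ℱ, F.card = T.m k ∧ α ∈ F := by
  obtain ⟨p, hkp, hp⟩ : ∃ p, k ≤ p ∧ ∃ F ∈ ℱ, F.card = T.m p ∧ α ∈ F := by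
    simpa using hS.exists_superset_of_le {α} (by simpa using hα) k
  induction p, hkp using Nat.le_induction with
  | base => exact hp
  | succ p _ ih =>
    obtain ⟨F, hF, hc, hαF⟩ := hp
    obtain ⟨D, R, h⟩ := hS.decomp p F hF hc
    obtain ⟨i, hi, hαi⟩ := h.exists_mem_piece hαF
    exact ih ⟨D i, (h.1 i hi).1, (h.1 i hi).2, hαi⟩

lemma mem_of_level_le (hS : IsConstructionScheme T ℱ) {j k : ℕ} (hjk : j ≤ k)
    {E : Finset Ordinal} (hE : E ∈ ℱ) (hEc : E.card = T.m j) {α ξ : Ordinal} (hα : α ∈ E)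
    (hξ : ξ ∈ E) (hξα : ξ ≤ α) {F : Finset Ordinal} (hF : F ∈ ℱ) (hFc : F.card = T.m k)
    (hαF : α ∈ F) : ξ ∈ F := by
  induction k, hjk using Nat.le_induction generalizing F with
  | base =>
    rcases hξα.eq_or_lt with rfl | hlt
    · exact hαF
    · exact (Finset.mem_inter.1 ((hS.inter_initSeg j E hE F hF hEc hFc).1 α
        (Finset.mem_inter.2 ⟨hα, hαF⟩) ξ hξ hlt)).2
  | succ k _ ih =>
    obtain ⟨D, R, h⟩ := hS.decomp k F hF hFc
    obtain ⟨i, hi, hαi⟩ := h.exists_mem_piece hαF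
    exact h.piece_subset hi (ih (h.1 i hi).1 (h.1 i hi).2 hαi)

lemma rho_le_iff (hS : IsConstructionScheme T ℱ) {k : ℕ} {F : Finset Ordinal} (hF : F ∈ ℱ)
    (hFc : F.card = T.m k) {α ξ : Ordinal} (hα : α ∈ F) (hξ : ξ < α) :
    rho T ℱ α ξ ≤ k ↔ ξ ∈ F := by
  refine ⟨fun h => ?_, fun h => Nat.sInf_le ⟨F, hF, hFc, hα, h⟩⟩
  have hα1 : α < omegaOne := hS.mem_subset F hF hα
  have hne : {k | ∃ F ∈ ℱ, F.card = T.m k ∧ α ∈ F ∧ ξ ∈ F}.Nonempty := by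
    obtain ⟨p, -, E, hE, hEc, hsub⟩ := hS.exists_superset_of_le {α, ξ} (by
      intro x hx
      rcases (by simpa using hx : x = α ∨ x = ξ) with rfl | rfl
      exacts [hα1, hξ.trans hα1]) 0
    exact ⟨p, E, hE, hEc, hsub (by simp), hsub (by simp)⟩
  obtain ⟨E, hE, hEc, hαE, hξE⟩ := Nat.sInf_mem hne
  exact hS.mem_of_level_le h hE hEc hαE hξE hξ.le hF hFc hα

lemma nrm_eq_card_filter (hS : IsConstructionScheme T ℱ) {k : ℕ} {F : Finset Ordinal}
    (hF : F ∈ ℱ) (hFc : F.card = T.m k) {α : Ordinal} (hα : α ∈ F) :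
    nrm T ℱ α k = (F.filter (· < α)).card := by
  rw [nrm, ← Set.ncard_coe_finset]
  congr 1
  ext ξ
  simp only [Set.mem_ofPred_eq, Finset.coe_filter]
  exact ⟨fun h => ⟨(hS.rho_le_iff hF hFc hα h.1).1 h.2, h.1⟩,
    fun h => ⟨h.2, (hS.rho_le_iff hF hFc hα h.2).2 h.1⟩⟩

lemma nrm_lt (hS : IsConstructionScheme T ℱ) {α : Ordinal} (hα : α < omegaOne) (k : ℕ) :
    nrm T ℱ α k < T.m k := by
  obtain ⟨F, hF, hFc, hαF⟩ := hS.exists_mem_level hα k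
  rw [hS.nrm_eq_card_filter hF hFc hαF, ← hFc]
  exact Finset.card_lt_card (Finset.filter_ssubset.2 ⟨α, hαF, lt_irrefl α⟩)

/-- Passing from level `k` to level `k + 1`, either `α` lies in the root, or `Ξ_α(k + 1)` is the
index of the piece containing `α`. -/
lemma Xi_succ_cases (hS : IsConstructionScheme T ℱ) {α : Ordinal} (hα : α < omegaOne) (k : ℕ) :
    (nrm T ℱ α k < T.r (k + 1) ∧ Xi T ℱ α (k + 1) = -1 ∧
      nrm T ℱ α (k + 1) = nrm T ℱ α k) ∨
    (T.r (k + 1) ≤ nrm T ℱ α k ∧ ∃ i < T.n (k + 1), Xi T ℱ α (k + 1) = i ∧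
      nrm T ℱ α (k + 1) = nrm T ℱ α k + i * (T.m k - T.r (k + 1))) := by
  have key : ∀ F ∈ ℱ, ∀ D R i, F.card = T.m (k + 1) → α ∈ F → IsDecomposition T ℱ k F D R →
      i < T.n (k + 1) → α ∈ D i → α ∉ R → T.r (k + 1) ≤ nrm T ℱ α k ∧
      nrm T ℱ α (k + 1) = nrm T ℱ α k + i * (T.m k - T.r (k + 1)) := by
    intro F hF D R i hFc hαF h hi hαi hαR
    rw [hS.nrm_eq_card_filter hF hFc hαF, hS.nrm_eq_card_filter (h.1 i hi).1 (h.1 i hi).2 hαi]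
    exact ⟨h.root_card_le hi hαi hαR, h.card_filter_lt_of_notMem_root hi hαi hαR⟩
  obtain ⟨F, hF, hFc, hαF⟩ := hS.exists_mem_level hα (k + 1)
  obtain ⟨D, R, h⟩ := hS.decomp k F hF hFc
  obtain ⟨i, hi, hαi⟩ := h.exists_mem_piece hαF
  by_cases hαR : α ∈ R
  · left
    have h1 : nrm T ℱ α (k + 1) = nrm T ℱ α k := by
      rw [hS.nrm_eq_card_filter hF hFc hαF, hS.nrm_eq_card_filter (h.1 i hi).1 (h.1 i hi).2 hαi,
        h.filter_lt_of_mem_root hi hαR]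
    have h2 : nrm T ℱ α k < T.r (k + 1) := by
      rw [← h1, hS.nrm_eq_card_filter hF hFc hαF]
      exact h.card_filter_lt_root hαR
    refine ⟨h2, ?_, h1⟩
    rw [Xi, if_neg k.succ_ne_zero, dif_neg]
    rintro ⟨i', F', hF', D', R', hFc', hαF', h', hi', hαi', hαR'⟩
    exact absurd h2 (key F' hF' D' R' i' hFc' hαF' h' hi' hαi' hαR').1.not_gt
  · right
    obtain ⟨h1, h2⟩ := key F hF D R i hFc hαF h hi hαi hαR
    refine ⟨h1, i, hi, ?_, h2⟩
    have hex : ∃ i : ℕ, ∃ F ∈ ℱ, ∃ D R, F.card = T.m (k + 1) ∧ α ∈ F ∧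
        IsDecomposition T ℱ (k + 1 - 1) F D R ∧ i < T.n (k + 1) ∧ α ∈ D i ∧ α ∉ R :=
      ⟨i, F, hF, D, R, hFc, hαF, h, hi, hαi, hαR⟩
    rw [Xi, if_neg k.succ_ne_zero, dif_pos hex]
    obtain ⟨F', hF', D', R', hFc', hαF', h', hi', hαi', hαR'⟩ := hex.choose_spec
    have h3 := (key F' hF' D' R' _ hFc' hαF' h' hi' hαi' hαR').2
    have hpos : 0 < T.m k - T.r (k + 1) := Nat.sub_pos_of_lt (T.r_lt k)
    exact_mod_cast Nat.eq_of_mul_eq_mul_right hpos (by omega)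

/-- The norm at level `k + 1` determines the norm at level `k` and the value of `Ξ`. -/
lemma nrm_Xi_eq_of_nrm_succ_eq (hS : IsConstructionScheme T ℱ) {α β : Ordinal}
    (hα : α < omegaOne) (hβ : β < omegaOne) {k : ℕ}
    (h : nrm T ℱ α (k + 1) = nrm T ℱ β (k + 1)) :
    nrm T ℱ α k = nrm T ℱ β k ∧ Xi T ℱ α (k + 1) = Xi T ℱ β (k + 1) := by
  have ha := hS.nrm_lt hα k
  have hb := hS.nrm_lt hβ k
  rcases hS.Xi_succ_cases hα k with ⟨a1, a2, a3⟩ | ⟨a1, i, -, a2, a3⟩ <;>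
    rcases hS.Xi_succ_cases hβ k with ⟨b1, b2, b3⟩ | ⟨b1, j, -, b2, b3⟩
  · exact ⟨by omega, by rw [a2, b2]⟩
  · omega
  · omega
  · obtain rfl : i = j := by
      by_contra hne
      rcases Nat.lt_or_gt_of_ne hne with hlt | hlt
      · have := Nat.mul_le_mul_right (T.m k - T.r (k + 1)) (Nat.succ_le_of_lt hlt)
        rw [Nat.succ_mul] at this
        omega
      · have := Nat.mul_le_mul_right (T.m k - T.r (k + 1)) (Nat.succ_le_of_lt hlt)
        rw [Nat.succ_mul] at this
        omega
    exact ⟨by omega, by rw [a2, b2]⟩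

lemma nrm_eq_of_le (hS : IsConstructionScheme T ℱ) {α β : Ordinal}
    (hα : α < omegaOne) (hβ : β < omegaOne) {j k : ℕ} (hjk : j ≤ k)
    (h : nrm T ℱ α k = nrm T ℱ β k) : nrm T ℱ α j = nrm T ℱ β j := by
  induction k, hjk using Nat.le_induction with
  | base => exact h
  | succ k _ ih => exact ih (hS.nrm_Xi_eq_of_nrm_succ_eq hα hβ h).1

lemma eSeq_eq_of_nrm_eq (hS : IsConstructionScheme T ℱ) (C : ℕ → ℕ → Finset ℕ) (nn : ℕ)
    {α β : Ordinal} (hα : α < omegaOne) (hβ : β < omegaOne) {j k : ℕ} (hjk : j ≤ k)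
    (h : nrm T ℱ α k = nrm T ℱ β k) : eSeq T ℱ C nn α j = eSeq T ℱ C nn β j := by
  have hj := hS.nrm_eq_of_le hα hβ hjk h
  cases j with
  | zero => simp [eSeq, Xi]
  | succ j =>
    obtain ⟨h1, h2⟩ := hS.nrm_Xi_eq_of_nrm_succ_eq hα hβ hj
    simp only [eSeq, Nat.add_sub_cancel, h1, h2]

lemma exists_nrm_ne (hS : IsConstructionScheme T ℱ) {α β : Ordinal}
    (hα : α < omegaOne) (hβ : β < omegaOne) (hne : α ≠ β) :
    ∃ k, nrm T ℱ α k ≠ nrm T ℱ β k := by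
  wlog hlt : α < β generalizing α β
  · obtain ⟨k, hk⟩ := this hβ hα hne.symm (hne.lt_or_gt.resolve_left hlt)
    exact ⟨k, hk.symm⟩
  obtain ⟨k, -, F, hF, hFc, hsub⟩ := hS.exists_superset_of_le {α, β} (by
    intro x hx
    rcases (by simpa using hx : x = α ∨ x = β) with rfl | rfl
    exacts [hα, hβ]) 0
  have hαF : α ∈ F := hsub (by simp)
  have hβF : β ∈ F := hsub (by simp)
  refine ⟨k, ne_of_lt ?_⟩
  rw [hS.nrm_eq_card_filter hF hFc hαF, hS.nrm_eq_card_filter hF hFc hβF]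
  refine Finset.card_lt_card ((Finset.ssubset_iff_of_subset fun x hx => ?_).2 ⟨α, ?_, by simp⟩)
  · rw [Finset.mem_filter] at hx ⊢
    exact ⟨hx.1, hx.2.trans hlt⟩
  · exact Finset.mem_filter.2 ⟨hαF, hlt⟩

/-- Distinct ordinals have equal norms up to some level `k`, after which they lie in different
pieces outside of the root. -/
lemma exists_split (hS : IsConstructionScheme T ℱ) {α β : Ordinal}
    (hα : α < omegaOne) (hβ : β < omegaOne) (hne : α ≠ β) :
    ∃ k, nrm T ℱ α k = nrm T ℱ β k ∧ nrm T ℱ α (k + 1) ≠ nrm T ℱ β (k + 1) ∧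
      ∃ i < T.n (k + 1), ∃ j < T.n (k + 1), i ≠ j ∧
        Xi T ℱ α (k + 1) = i ∧ Xi T ℱ β (k + 1) = j := by
  have hex := hS.exists_nrm_ne hα hβ hne
  have h0 : nrm T ℱ α 0 = nrm T ℱ β 0 := by
    have ha := hS.nrm_lt hα 0
    have hb := hS.nrm_lt hβ 0
    rw [T.m_zero] at ha hb
    omega
  obtain ⟨k, hk⟩ : ∃ k, Nat.find hex = k + 1 :=
    Nat.exists_eq_succ_of_ne_zero fun h => Nat.find_spec hex (h ▸ h0)
  have heq : nrm T ℱ α k = nrm T ℱ β k :=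
    not_not.1 (Nat.find_min hex (hk ▸ Nat.lt_succ_self k))
  have hd : nrm T ℱ α (k + 1) ≠ nrm T ℱ β (k + 1) := hk ▸ Nat.find_spec hex
  refine ⟨k, heq, hd, ?_⟩
  rcases hS.Xi_succ_cases hα k with ⟨a1, a2, a3⟩ | ⟨a1, i, hi, a2, a3⟩ <;>
    rcases hS.Xi_succ_cases hβ k with ⟨b1, b2, b3⟩ | ⟨b1, j, hj, b2, b3⟩
  · omega
  · omega
  · omega
  · refine ⟨i, hi, j, hj, ?_, a2, b2⟩
    rintro rfl
    omega

lemma natAbs_eSeq (C : ℕ → ℕ → Finset ℕ) (nn : ℕ) {α : Ordinal} {k i : ℕ}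
    (h : Xi T ℱ α k = i) : (eSeq T ℱ C nn α k).natAbs = i := by
  simp only [eSeq, h]
  split_ifs <;> omega

lemma eSeq_injOn (hS : IsConstructionScheme T ℱ) (C : ℕ → ℕ → Finset ℕ) (nn : ℕ) :
    Set.InjOn (fun α => toLex (eSeq T ℱ C nn α)) (Set.Iio omegaOne) := by
  intro α hα β hβ h
  by_contra hne
  obtain ⟨k, -, -, i, -, j, -, hij, hi, hj⟩ := hS.exists_split hα hβ hne
  apply hij
  rw [← natAbs_eSeq C nn hi, ← natAbs_eSeq C nn hj, toLex_inj.1 h]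

/-- The norms of the elements of an interval contained in one member of the scheme. -/
lemma nrm_block (hS : IsConstructionScheme T ℱ) {γ : Ordinal} {M k₀ k : ℕ} (hk : k₀ ≤ k)
    {E : Finset Ordinal} (hE : E ∈ ℱ) (hEc : E.card = T.m k₀) (hmem : ∀ t ≤ M, block γ t ∈ E)
    {t : ℕ} (ht : t ≤ M) : nrm T ℱ (block γ t) k = nrm T ℱ (block γ 0) k + t := by
  obtain ⟨F, hF, hFc, hMF⟩ := hS.exists_mem_level (hS.mem_subset E hE (hmem M le_rfl)) k
  have hmono : StrictMono (block γ) := fun s t hst => by simpa [block] using hst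
  have hFm : ∀ t ≤ M, block γ t ∈ F := fun t ht =>
    hS.mem_of_level_le hk hE hEc (hmem M le_rfl) (hmem t ht) (hmono.monotone ht) hF hFc hMF
  induction t with
  | zero => simp
  | succ t ih =>
    have ih' := ih (by omega)
    have h1 : F.filter (· < block γ (t + 1)) = insert (block γ t) (F.filter (· < block γ t)) := by
      have hsucc : block γ (t + 1) = Order.succ (block γ t) := by
        simp [block, add_assoc]
      ext x
      simp only [hsucc, Order.lt_succ_iff, Finset.mem_filter, Finset.mem_insert, le_iff_eq_or_lt]
      refine ⟨fun h => h.2.imp id fun hx => ⟨h.1, hx⟩, ?_⟩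
      rintro (rfl | h)
      · exact ⟨hFm t (by omega), Or.inl rfl⟩
      · exact ⟨h.1, Or.inr h.2⟩
    rw [hS.nrm_eq_card_filter hF hFc (hFm t (by omega))] at ih'
    rw [hS.nrm_eq_card_filter hF hFc (hFm _ ht), h1, Finset.card_insert_of_notMem (by simp), ih',
      add_assoc]

end IsConstructionScheme

/-- The set of norms at which `eSeq` is positive when the relevant set is `s`. -/
def PosAt (nn : ℕ) (s : Finset ℕ) (x : ℕ) : Prop := x ∈ s ∨ (s.card = nn ∧ ∀ c ∈ s, x < c)

lemma eSeq_of_Xi_pos {T : SchemeType} {ℱ : Set (Finset Ordinal)} {C : ℕ → ℕ → Finset ℕ} {nn : ℕ}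
    {α : Ordinal} {k i : ℕ} (h : Xi T ℱ α (k + 1) = i) (hi : 0 < i) :
    eSeq T ℱ C nn α (k + 1) = if PosAt nn (C k i) (nrm T ℱ α k) then (i : ℤ) else -i := by
  simp only [eSeq, h, PosAt]
  rw [if_neg (by omega)]
  simp only [Int.toNat_natCast, Nat.add_sub_cancel]
  congr

/-- A monotone sequence of length `2 * nn + 1` cannot alternate with respect to `PosAt`. -/
lemma not_alternating_of_strictMono {nn : ℕ} (hn : 1 ≤ nn) {s : Finset ℕ} (hs : s.card ≤ nn)
    {q : ℕ → ℕ} (hq : StrictMonoOn q (Set.Iic (2 * nn))) :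
    ¬ (∀ t ≤ 2 * nn, PosAt nn s (q t) ↔ Even t) ∧
    ¬ (∀ t ≤ 2 * nn, PosAt nn s (q t) ↔ ¬ Even t) := by
  have hlt : ∀ a b, a < b → b ≤ 2 * nn → q a < q b := fun a b hab hb =>
    hq (Set.mem_Iic.2 (by omega)) (Set.mem_Iic.2 hb) hab
  have hcard : ∀ (N : ℕ) (f : ℕ → ℕ), (∀ j < N, f j ≤ 2 * nn) → StrictMono f →
      (∀ j < N, q (f j) ∈ s) → N ≤ (s.filter (q (f 0) ≤ ·)).card := by
    intro N f hf hfm hmem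
    rw [← Finset.card_range N]
    refine Finset.card_le_card_of_injOn (fun j => q (f j)) (fun j hj => ?_) ?_
    · have hj' : j < N := by simpa using hj
      refine Finset.mem_coe.2 (Finset.mem_filter.2 ⟨hmem j hj', ?_⟩)
      rcases Nat.eq_zero_or_pos j with rfl | h0
      · exact le_rfl
      · exact (hlt _ _ (hfm h0) (hf j hj')).le
    · intro a ha b hb hab
      have ha' : a < N := by simpa using ha
      have hb' : b < N := by simpa using hb
      exact hfm.injective (hq.injOn (Set.mem_Iic.2 (hf a ha')) (Set.mem_Iic.2 (hf b hb')) hab)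
  have hcard' : ∀ (f : ℕ → ℕ), (∀ j < nn, f j ≤ 2 * nn) → StrictMono f →
      (∀ j < nn, q (f j) ∈ s) → ∀ c ∈ s, ¬ c < q (f 0) := by
    intro f hf hfm hmem c hc hcl
    have h1 := hcard nn f hf hfm hmem
    have h2 : (s.filter (q (f 0) ≤ ·)).card < s.card :=
      Finset.card_lt_card (Finset.filter_ssubset.2 ⟨c, hc, hcl.not_ge⟩)
    omega
  have hgap : ∀ {x}, ¬ PosAt nn s x → s.card = nn → ∃ c ∈ s, c < x := by
    intro x hx hsc
    simp only [PosAt, not_or, not_and, not_forall, not_lt] at hx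
    obtain ⟨c, hc, hcx⟩ := hx.2 hsc
    exact ⟨c, hc, hcx.lt_of_ne fun h => hx.1 (h ▸ hc)⟩
  constructor
  · intro h
    by_cases hsc : s.card = nn
    · obtain ⟨c, hc, hc1⟩ := hgap (mt (h 1 (by omega)).1 (by decide)) hsc
      refine hcard' (fun j => 2 * j + 2) (fun j hj => by omega) (fun a b hab => by dsimp; omega)
        (fun j hj => ?_) c hc (hc1.trans (hlt _ _ (by omega) (by omega)))
      refine ((h (2 * j + 2) (by omega)).2 (by simp [parity_simps])).resolve_right fun hh => ?_
      exact absurd (hh.2 c hc) (hc1.trans (hlt _ _ (by omega) (by omega))).not_gt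
    · have h1 := hcard (nn + 1) (fun j => 2 * j) (fun j hj => by omega)
        (fun a b hab => by dsimp; omega) fun j hj =>
          ((h (2 * j) (by omega)).2 (by simp)).resolve_right fun hh => hsc hh.1
      have h2 := Finset.card_filter_le s (q (2 * 0) ≤ ·)
      omega
  · intro h
    by_cases hsc : s.card = nn
    · obtain ⟨c, hc, hc0⟩ := hgap (mt (h 0 (by omega)).1 (by decide)) hsc
      refine hcard' (fun j => 2 * j + 1) (fun j hj => by omega) (fun a b hab => by dsimp; omega)
        (fun j hj => ?_) c hc (hc0.trans (hlt _ _ (by omega) (by omega)))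
      refine ((h (2 * j + 1) (by omega)).2 (by simp [parity_simps])).resolve_right fun hh => ?_
      exact absurd (hh.2 c hc) (hc0.trans (hlt _ _ (by omega) (by omega))).not_gt
    · have h1 := hcard nn (fun j => 2 * j + 1) (fun j hj => by omega)
        (fun a b hab => by dsimp; omega) fun j hj =>
          ((h (2 * j + 1) (by omega)).2 (by simp [parity_simps])).resolve_right fun hh => hsc hh.1
      have h2 := Finset.card_filter_le s (q (2 * 0 + 1) ≤ ·)
      omega

lemma not_alternating {nn : ℕ} (hn : 1 ≤ nn) {s : Finset ℕ} (hs : s.card ≤ nn)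
    {q : ℕ → ℕ} (hq : StrictMonoOn q (Set.Iic (2 * nn)) ∨ StrictAntiOn q (Set.Iic (2 * nn))) :
    ¬ (∀ t ≤ 2 * nn, PosAt nn s (q t) ↔ Even t) ∧
    ¬ (∀ t ≤ 2 * nn, PosAt nn s (q t) ↔ ¬ Even t) := by
  rcases hq with hq | hq
  · exact not_alternating_of_strictMono hn hs hq
  have hq' : StrictMonoOn (fun t => q (2 * nn - t)) (Set.Iic (2 * nn)) := fun a ha b hb hab =>
    hq (Set.mem_Iic.2 (by omega)) (Set.mem_Iic.2 (by omega))
      (by have := Set.mem_Iic.1 hb; omega)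
  have hev : ∀ t ≤ 2 * nn, (Even (2 * nn - t) ↔ Even t) := fun t ht => by
    rw [Nat.even_sub ht]; simp
  obtain ⟨h1, h2⟩ := not_alternating_of_strictMono hn hs hq'
  exact ⟨fun h => h1 fun t ht => (h (2 * nn - t) (by omega)).trans (hev t ht),
    fun h => h2 fun t ht => (h (2 * nn - t) (by omega)).trans (not_congr (hev t ht))⟩

/-- Every injective sequence in a linear order has, for each `N`, a strictly increasing selection
of length `N + 1` whose indices are monotone. -/
lemma exists_monotone_selection {X : Type*} [LinearOrder X] {f : ℕ → X}
    (hf : Function.Injective f) (N : ℕ) :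
    ∃ h : ℕ → ℕ, (StrictMonoOn h (Set.Iic N) ∨ StrictAntiOn h (Set.Iic N)) ∧
      StrictMonoOn (f ∘ h) (Set.Iic N) := by
  obtain ⟨g, hg | hg⟩ := exists_increasing_or_nonincreasing_subseq (· < ·) f
  · exact ⟨g, Or.inl (g.strictMono.strictMonoOn _), fun a _ b _ hab => hg a b hab⟩
  · refine ⟨fun t => g (N - t), Or.inr fun a ha b hb hab => g.strictMono ?_,
      fun a ha b hb hab => ?_⟩
    · have := Set.mem_Iic.1 hb
      omega
    · have hlt : N - b < N - a := by have := Set.mem_Iic.1 hb; omega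
      exact (not_lt.1 (hg _ _ hlt)).lt_of_ne (hf.ne (g.injective.ne (by omega)))

/-- Two sequences whose first difference is at `k + 1`, where their absolute values are distinct,
are compared by the sign of the one with the larger absolute value. -/
lemma eSeq_lt_iff {T : SchemeType} {ℱ : Set (Finset Ordinal)} (hS : IsConstructionScheme T ℱ)
    (C : ℕ → ℕ → Finset ℕ) (nn : ℕ) {α β : Ordinal} (hα : α < omegaOne) (hβ : β < omegaOne)
    {k i j : ℕ} (h : nrm T ℱ α k = nrm T ℱ β k) (hi : Xi T ℱ α (k + 1) = i)
    (hj : Xi T ℱ β (k + 1) = j) (hij : i ≠ j) :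
    toLex (eSeq T ℱ C nn α) < toLex (eSeq T ℱ C nn β) ↔
      if i < j then PosAt nn (C k j) (nrm T ℱ β k) else ¬ PosAt nn (C k i) (nrm T ℱ α k) := by
  have hlow : ∀ p < k + 1, eSeq T ℱ C nn α p = eSeq T ℱ C nn β p := fun p hp =>
    hS.eSeq_eq_of_nrm_eq C nn hα hβ (Nat.le_of_lt_succ hp) h
  have hai := IsConstructionScheme.natAbs_eSeq C nn hi
  have hbj := IsConstructionScheme.natAbs_eSeq C nn hj
  have hiff : toLex (eSeq T ℱ C nn α) < toLex (eSeq T ℱ C nn β) ↔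
      eSeq T ℱ C nn α (k + 1) < eSeq T ℱ C nn β (k + 1) := by
    constructor
    · rintro ⟨p, hp, hlt⟩
      rcases lt_trichotomy p (k + 1) with hpk | rfl | hpk
      · exact absurd hlt (by simp [hlow p hpk])
      · exact hlt
      · have : eSeq T ℱ C nn α (k + 1) = eSeq T ℱ C nn β (k + 1) := hp _ hpk
        omega
    · exact fun hlt => ⟨k + 1, hlow, hlt⟩
  rw [hiff]
  split_ifs with hlt
  · rw [eSeq_of_Xi_pos (C := C) (nn := nn) hj (by omega)] at hbj ⊢
    split_ifs with hP <;> simp only [hP, iff_true, iff_false] <;> omega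
  · rw [eSeq_of_Xi_pos (C := C) (nn := nn) hi (by omega)] at hai ⊢
    split_ifs with hP <;> simp only [hP, not_true, not_false_iff, iff_true, iff_false] <;> omega

/-- Two blocks with the same norm at a common level do not realize an alternating type. -/
lemma block_not_alternating {T : SchemeType} {ℱ : Set (Finset Ordinal)}
    (hS : IsConstructionScheme T ℱ) {C : ℕ → ℕ → Finset ℕ} {nn : ℕ} (hn : 1 ≤ nn)
    (hC : ∀ k, ∀ i, 0 < i → i < T.n (k + 1) → (C k i).card ≤ nn)
    {γ γ' : Ordinal} (hne : γ ≠ γ') {M k₀ : ℕ} {E E' : Finset Ordinal} (hE : E ∈ ℱ)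
    (hE' : E' ∈ ℱ) (hEc : E.card = T.m k₀) (hEc' : E'.card = T.m k₀)
    (hmem : ∀ t ≤ M, block γ t ∈ E) (hmem' : ∀ t ≤ M, block γ' t ∈ E')
    (hnrm : nrm T ℱ (block γ 0) k₀ = nrm T ℱ (block γ' 0) k₀) {h : ℕ → ℕ}
    (hh : StrictMonoOn h (Set.Iic (2 * nn)) ∨ StrictAntiOn h (Set.Iic (2 * nn)))
    (hM : ∀ t ≤ 2 * nn, h t ≤ M) :
    ¬ (∀ t ≤ 2 * nn, toLex (eSeq T ℱ C nn (block γ (h t))) <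
      toLex (eSeq T ℱ C nn (block γ' (h t))) ↔ Even t) ∧
    ¬ (∀ t ≤ 2 * nn, toLex (eSeq T ℱ C nn (block γ (h t))) <
      toLex (eSeq T ℱ C nn (block γ' (h t))) ↔ ¬ Even t) := by
  have hlt : ∀ t ≤ M, block γ t < omegaOne := fun t ht => hS.mem_subset E hE (hmem t ht)
  have hlt' : ∀ t ≤ M, block γ' t < omegaOne := fun t ht => hS.mem_subset E' hE' (hmem' t ht)
  obtain ⟨k, hk, hk1, i, hi, j, hj, hij, hXi, hXj⟩ := hS.exists_split (hlt 0 M.zero_le)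
    (hlt' 0 M.zero_le) fun he => hne (block_inj he).1
  have hk₀ : k₀ ≤ k := by
    by_contra hcon
    exact hk1 (hS.nrm_eq_of_le (hlt 0 M.zero_le) (hlt' 0 M.zero_le) (by omega) hnrm)
  have hXblock : ∀ {γ : Ordinal} {E : Finset Ordinal} {i : ℕ}, E ∈ ℱ → E.card = T.m k₀ →
      (∀ t ≤ M, block γ t ∈ E) → Xi T ℱ (block γ 0) (k + 1) = i → ∀ t ≤ M,
      Xi T ℱ (block γ t) (k + 1) = i := by
    intro γ E i hE hEc hmem hXi t ht
    have b0 := hS.nrm_block hk₀ hE hEc hmem ht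
    have b1 := hS.nrm_block (hk₀.trans k.le_succ) hE hEc hmem ht
    have hpos : 0 < T.m k - T.r (k + 1) := Nat.sub_pos_of_lt (T.r_lt k)
    rcases hS.Xi_succ_cases (hS.mem_subset E hE (hmem 0 M.zero_le)) k with
      ⟨-, a2, -⟩ | ⟨a1, i', -, a2, a3⟩
    · omega
    rcases hS.Xi_succ_cases (hS.mem_subset E hE (hmem t ht)) k with
      ⟨c1, -, -⟩ | ⟨-, i'', -, c2, c3⟩
    · omega
    rw [Nat.succ_eq_add_one] at b1
    have : i'' = i' := Nat.eq_of_mul_eq_mul_right hpos (by omega)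
    omega
  have hcmp : ∀ t ≤ 2 * nn, (toLex (eSeq T ℱ C nn (block γ (h t))) <
      toLex (eSeq T ℱ C nn (block γ' (h t))) ↔
      if i < j then PosAt nn (C k j) (nrm T ℱ (block γ 0) k + h t)
      else ¬ PosAt nn (C k i) (nrm T ℱ (block γ 0) k + h t)) := by
    intro t ht
    have hb := hS.nrm_block hk₀ hE hEc hmem (hM t ht)
    have hb' := hS.nrm_block hk₀ hE' hEc' hmem' (hM t ht)
    rw [← hk] at hb'
    rw [eSeq_lt_iff hS C nn (hlt _ (hM t ht)) (hlt' _ (hM t ht)) (hb.trans hb'.symm)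
      (hXblock hE hEc hmem hXi _ (hM t ht)) (hXblock hE' hEc' hmem' hXj _ (hM t ht)) hij, hb, hb']
  have hq : StrictMonoOn (fun t => nrm T ℱ (block γ 0) k + h t) (Set.Iic (2 * nn)) ∨
      StrictAntiOn (fun t => nrm T ℱ (block γ 0) k + h t) (Set.Iic (2 * nn)) :=
    hh.imp (fun hh a ha b hb hab => Nat.add_lt_add_left (hh ha hb hab) _)
      fun hh a ha b hb hab => Nat.add_lt_add_left (hh ha hb hab) _
  rcases Nat.lt_or_gt_of_ne hij with hlt | hlt
  · obtain ⟨h1, h2⟩ := not_alternating hn (hC k j (by omega) hj) hq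
    simp only [if_pos hlt] at hcmp
    exact ⟨fun hh => h1 fun t ht => (hcmp t ht).symm.trans (hh t ht),
      fun hh => h2 fun t ht => (hcmp t ht).symm.trans (hh t ht)⟩
  · obtain ⟨h1, h2⟩ := not_alternating hn (hC k i (by omega) hi) hq
    simp only [if_neg hlt.not_gt] at hcmp
    exact ⟨fun hh => h2 fun t ht => by rw [← hh t ht, hcmp t ht, not_not],
      fun hh => h1 fun t ht => not_iff_not.1 ((hcmp t ht).symm.trans (hh t ht))⟩

/-- There are an uncountable set of blocks, one pattern of indices and one level at which all
these blocks look alike. -/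
lemma exists_uniform_blocks {T : SchemeType} {ℱ : Set (Finset Ordinal)}
    (hS : IsConstructionScheme T ℱ) (C : ℕ → ℕ → Finset ℕ) (nn N : ℕ) :
    ∃ (h : ℕ → ℕ) (M k₀ p : ℕ) (Γ : Set Ordinal), ¬ Γ.Countable ∧ Γ ⊆ Set.Iio omegaOne ∧
      (StrictMonoOn h (Set.Iic N) ∨ StrictAntiOn h (Set.Iic N)) ∧ (∀ t ≤ N, h t ≤ M) ∧
      ∀ γ ∈ Γ, StrictMonoOn (fun t => toLex (eSeq T ℱ C nn (block γ (h t)))) (Set.Iic N) ∧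
        nrm T ℱ (block γ 0) k₀ = p ∧
        ∃ E ∈ ℱ, E.card = T.m k₀ ∧ ∀ t ≤ M, block γ t ∈ E := by
  let Good : Ordinal → (Fin (N + 1) → ℕ) × ℕ × ℕ × ℕ → Prop := fun γ d =>
    let h : ℕ → ℕ := fun t => d.1 (Fin.ofNat (N + 1) t)
    (StrictMonoOn h (Set.Iic N) ∨ StrictAntiOn h (Set.Iic N)) ∧ (∀ t ≤ N, h t ≤ d.2.1) ∧
      StrictMonoOn (fun t => toLex (eSeq T ℱ C nn (block γ (h t)))) (Set.Iic N) ∧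
      nrm T ℱ (block γ 0) d.2.2.1 = d.2.2.2 ∧
      ∃ E ∈ ℱ, E.card = T.m d.2.2.1 ∧ ∀ t ≤ d.2.1, block γ t ∈ E
  have hgood : ∀ γ < omegaOne, ∃ d, Good γ d := by
    intro γ hγ
    have hinj : Function.Injective fun t : ℕ => toLex (eSeq T ℱ C nn (block γ t)) :=
      fun s t hst => (block_inj (hS.eSeq_injOn C nn (block_lt_omegaOne hγ s)
        (block_lt_omegaOne hγ t) hst)).2
    obtain ⟨h, hh, hmono⟩ := exists_monotone_selection hinj N
    let M := (Finset.range (N + 1)).sup h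
    obtain ⟨k₀, -, E, hE, hEc, hsub⟩ := hS.exists_superset_of_le
      ((Finset.range (M + 1)).image (block γ)) (by
        intro x hx
        obtain ⟨t, -, rfl⟩ := Finset.mem_image.1 (Finset.mem_coe.1 hx)
        exact block_lt_omegaOne hγ t) 0
    have hval : ∀ t ∈ Set.Iic N, h (Fin.ofNat (N + 1) t : Fin (N + 1)) = h t := fun t ht => by
      simp [Nat.mod_eq_of_lt (Nat.lt_succ_of_le (Set.mem_Iic.1 ht))]
    refine ⟨(fun t => h t, M, k₀, nrm T ℱ (block γ 0) k₀), ?_, ?_, ?_, rfl, E, hE, hEc, ?_⟩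
    · exact hh.imp (fun hh => hh.congr fun t ht => (hval t ht).symm)
        fun hh => hh.congr fun t ht => (hval t ht).symm
    · intro t ht
      dsimp only
      rw [hval t ht]
      exact Finset.le_sup (f := h) (Finset.mem_range.2 (Nat.lt_succ_of_le ht))
    · refine hmono.congr fun t ht => ?_
      dsimp only [Function.comp]
      rw [hval t ht]
    · exact fun t ht => hsub (Finset.mem_image_of_mem _ (Finset.mem_range.2 (Nat.lt_succ_of_le ht)))
  obtain ⟨d, hd⟩ : ∃ d, ¬ {γ | γ < omegaOne ∧ Good γ d}.Countable := by
    by_contra! hcon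
    refine not_countable_Iio_omegaOne ((Set.countable_iUnion hcon).mono fun γ hγ => ?_)
    obtain ⟨d, hd⟩ := hgood γ hγ
    exact Set.mem_iUnion.2 ⟨d, hγ, hd⟩
  obtain ⟨γ₀, -, hγ₀⟩ : {γ | γ < omegaOne ∧ Good γ d}.Nonempty := by
    by_contra hemp
    exact hd (Set.not_nonempty_iff_eq_empty.1 hemp ▸ Set.countable_empty)
  exact ⟨_, d.2.1, d.2.2.1, d.2.2.2, _, hd, fun γ hγ => hγ.1, hγ₀.1, hγ₀.2.1,
    fun γ hγ => hγ.2.2.2⟩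

/-- Under the same hypotheses, `𝔼_e` is not `(2n+1)`-entangled: there is an uncountable family
of pairwise disjoint `(2n+1)`-element subsets of `𝔼_e` no two distinct members of which realize
the alternating type (`0` at even coordinates, `1` at odd ones) nor its flip. -/
theorem stmt5 (T : SchemeType) (ℱ : Set (Finset Ordinal))
    (hS : IsConstructionScheme T ℱ) (hcap : FullyDeltaCapturing T ℱ)
    (hgrow : ∀ k, 2 ^ T.m k ≤ T.n (k + 1))
    (nn : ℕ) (hn : 1 ≤ nn) (C : ℕ → ℕ → Finset ℕ) (hC : IsGoodEnum T nn C) :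
    ¬ IsNEntangled ((fun α => toLex (eSeq T ℱ C nn α)) '' Set.Iio omegaOne) (2 * nn + 1) ∧
    ∃ 𝒜 : Set (Fin (2 * nn + 1) → Lex (ℕ → ℤ)),
      (∀ a ∈ 𝒜, StrictMono a ∧
        ∀ i, a i ∈ (fun α => toLex (eSeq T ℱ C nn α)) '' Set.Iio omegaOne) ∧
      (𝒜.Pairwise fun a b => ∀ i j, a i ≠ b j) ∧
      ¬ 𝒜.Countable ∧
      ∀ a ∈ 𝒜, ∀ b ∈ 𝒜, a ≠ b →
        ¬ (∀ i : Fin (2 * nn + 1), a i < b i ↔ Even (i : ℕ)) ∧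
        ¬ (∀ i : Fin (2 * nn + 1), a i < b i ↔ ¬ Even (i : ℕ)) := by
  have main : ∃ 𝒜 : Set (Fin (2 * nn + 1) → Lex (ℕ → ℤ)),
      (∀ a ∈ 𝒜, StrictMono a ∧
        ∀ i, a i ∈ (fun α => toLex (eSeq T ℱ C nn α)) '' Set.Iio omegaOne) ∧
      (𝒜.Pairwise fun a b => ∀ i j, a i ≠ b j) ∧
      ¬ 𝒜.Countable ∧
      ∀ a ∈ 𝒜, ∀ b ∈ 𝒜, a ≠ b →
        ¬ (∀ i : Fin (2 * nn + 1), a i < b i ↔ Even (i : ℕ)) ∧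
        ¬ (∀ i : Fin (2 * nn + 1), a i < b i ↔ ¬ Even (i : ℕ)) := by
    obtain ⟨h, M, k₀, p, Γ, hΓ, hΓlt, hh, hM, huni⟩ := exists_uniform_blocks hS C nn (2 * nn)
    let A : Ordinal → Fin (2 * nn + 1) → Lex (ℕ → ℤ) := fun γ t =>
      toLex (eSeq T ℱ C nn (block γ (h t)))
    have hA : ∀ γ ∈ Γ, ∀ γ' ∈ Γ, ∀ i j, A γ i = A γ' j → γ = γ' := fun γ hγ γ' hγ' i j he =>
      (block_inj (hS.eSeq_injOn C nn (block_lt_omegaOne (hΓlt hγ) _)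
        (block_lt_omegaOne (hΓlt hγ') _) he)).1
    refine ⟨A '' Γ, ?_, ?_, ?_, ?_⟩
    · rintro _ ⟨γ, hγ, rfl⟩
      exact ⟨fun i j hij => (huni γ hγ).1 (Nat.le_of_lt_succ i.2) (Nat.le_of_lt_succ j.2) hij,
        fun i => ⟨_, block_lt_omegaOne (hΓlt hγ) _, rfl⟩⟩
    · rintro _ ⟨γ, hγ, rfl⟩ _ ⟨γ', hγ', rfl⟩ hne i j he
      exact hne (congrArg A (hA γ hγ γ' hγ' i j he))
    · exact fun hc => hΓ (Set.countable_of_injective_of_countable_image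
        (fun γ hγ γ' hγ' he => hA γ hγ γ' hγ' 0 0 (congrFun he 0)) hc)
    · rintro _ ⟨γ, hγ, rfl⟩ _ ⟨γ', hγ', rfl⟩ hne
      obtain ⟨-, hp, E, hE, hEc, hmem⟩ := huni γ hγ
      obtain ⟨-, hp', E', hE', hEc', hmem'⟩ := huni γ' hγ'
      obtain ⟨h1, h2⟩ := block_not_alternating hS hn (fun k i hi hi' => (hC.1 k i hi hi').2)
        (fun he => hne (congrArg A he)) hE hE' hEc hEc' hmem hmem' (hp.trans hp'.symm) hh hM
      exact ⟨fun hcon => h1 fun t ht => hcon ⟨t, Nat.lt_succ_of_le ht⟩,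
        fun hcon => h2 fun t ht => hcon ⟨t, Nat.lt_succ_of_le ht⟩⟩
  refine ⟨fun hent => ?_, main⟩
  obtain ⟨𝒜, h1, h2, h3, h4⟩ := main
  obtain ⟨a, ha, b, hb, hab, hτ⟩ :=
    hent.2 (fun i => if Even (i : ℕ) then 0 else 1) 𝒜 h1 h2 h3
  refine (h4 a ha b hb hab).1 fun i => (hτ i).trans ?_
  by_cases hi : Even (i : ℕ) <;> simp [hi]

end
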